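/- arXiv:2008.10475 — 6 statements merged into one kernel-verified Lean document; each statement's English description precedes it below -/
import Mathlib

section
/- Let L be a mixed 1-stack 1-queue layout of G(k,ℓ) with k > 1 and ℓ > 4. Then the vertices and edges of the subgraph G(k-1,ℓ) do not form Pattern P.2 in L: there are no seven vertices p1,…,p7 of G(k-1,ℓ), ordered p1 ≺ p2 ≺ … ≺ p7 or p7 ≺ p6 ≺ … ≺ p1, such that {p1,p7}, {p2,p4}, {p2,p5} are stack-edges of G(k-1,ℓ) and {p1,p6}, {p3,p7} are queue-edges of G(k-1,ℓ). -/
/-- Vertices for the graphs `G(k,ℓ)`: two base vertices and, for each step `k`,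
each oriented edge `(u,v)` and each index `i : Fin ℓ`, a potential attached vertex. -/
inductive PV (ℓ : ℕ) : Type where
  | A : PV ℓ
  | B : PV ℓ
  | att : ℕ → PV ℓ → PV ℓ → Fin ℓ → PV ℓ

/-- The (canonically oriented) edges of `G(k,ℓ)`: `G(1,ℓ)` is the single edge `(A,B)`,
and for `k > 1`, `G(k,ℓ)` is obtained from `G(k-1,ℓ)` by attaching `ℓ` new vertices
to each of its edges. -/
def Gedges (ℓ : ℕ) : ℕ → Set (PV ℓ × PV ℓ)
  | 0 => ∅
  | 1 => {p | p = (PV.A, PV.B)}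
  | (k + 2) => Gedges ℓ (k + 1) ∪
      {p | ∃ u v, ∃ i : Fin ℓ, (u, v) ∈ Gedges ℓ (k + 1) ∧
        (p = (PV.att (k + 2) u v i, u) ∨ p = (PV.att (k + 2) u v i, v))}

/-- The graph `G(k,ℓ)`. -/
def Gkl (k ℓ : ℕ) : SimpleGraph (PV ℓ) :=
  SimpleGraph.fromEdgeSet ((fun p => s(p.1, p.2)) '' Gedges ℓ k)

/-- The graph `Ḡ(k,ℓ)` induced by the edges of `G(k,ℓ)` that are not in `G(k-1,ℓ)`. -/
def Gbar (k ℓ : ℕ) : SimpleGraph (PV ℓ) :=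
  SimpleGraph.fromEdgeSet ((fun p => s(p.1, p.2)) '' (Gedges ℓ k \ Gedges ℓ (k - 1)))

/-- A mixed 1-stack 1-queue layout of a graph `G`: a strict total (linear) order `lt`
on the vertices together with an assignment of each edge to the stack (`isStack e`)
or to the queue (`¬ isStack e`), such that no two stack-edges cross and no two
queue-edges nest. -/
structure MixedLayout {V : Type} (G : SimpleGraph V) where
  lt : V → V → Prop
  isSTO : IsStrictTotalOrder V lt
  isStack : Sym2 V → Prop
  noCross : ∀ a b c d : V, G.Adj a b → G.Adj c d →
    isStack s(a, b) → isStack s(c, d) → ¬(lt a c ∧ lt c b ∧ lt b d)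
  noNest : ∀ a b c d : V, G.Adj a b → G.Adj c d →
    ¬isStack s(a, b) → ¬isStack s(c, d) → ¬(lt a c ∧ lt c d ∧ lt d b)

/-- `{a,b}` is an edge of the subgraph `H` that is a stack-edge in the layout `L`. -/
def SEdgeIn {V : Type} {G : SimpleGraph V} (L : MixedLayout G) (H : SimpleGraph V)
    (a b : V) : Prop :=
  H.Adj a b ∧ L.isStack s(a, b)

/-- `{a,b}` is an edge of the subgraph `H` that is a queue-edge in the layout `L`. -/
def QEdgeIn {V : Type} {G : SimpleGraph V} (L : MixedLayout G) (H : SimpleGraph V)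
    (a b : V) : Prop :=
  H.Adj a b ∧ ¬L.isStack s(a, b)

/-- `x` is a stack-attachment of the edge `{u,v}`: both `{x,u}` and `{x,v}` are
stack-edges. -/
def StackAtt {V : Type} {G : SimpleGraph V} (L : MixedLayout G) (x u v : V) : Prop :=
  SEdgeIn L G x u ∧ SEdgeIn L G x v

/-- `x` is a queue-attachment of the edge `{u,v}`: both `{x,u}` and `{x,v}` are
queue-edges. -/
def QueueAtt {V : Type} {G : SimpleGraph V} (L : MixedLayout G) (x u v : V) : Prop :=
  QEdgeIn L G x u ∧ QEdgeIn L G x v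

/-- `x` is a mixed-attachment of the edge `{u,v}`: one of `{x,u}`, `{x,v}` is a
stack-edge and the other is a queue-edge. -/
def MixedAtt {V : Type} {G : SimpleGraph V} (L : MixedLayout G) (x u v : V) : Prop :=
  (SEdgeIn L G x u ∧ QEdgeIn L G x v) ∨ (QEdgeIn L G x u ∧ SEdgeIn L G x v)

/-- `x` is one of the vertices of `Ḡ(k,ℓ)` attached to the edge `{u,v}`, i.e. both
`{x,u}` and `{x,v}` are edges of `Ḡ(k,ℓ)`. -/
def AttachedAt (ℓ k : ℕ) (x u v : PV ℓ) : Prop :=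
  (Gbar k ℓ).Adj x u ∧ (Gbar k ℓ).Adj x v

/-- A smiley face `⟨a,b,u,v,c,d⟩` formed by vertices and edges of the subgraph `H`
in the layout `L`: `a ≺ b ≺ u ≺ v ≺ c ≺ d`, the edges `{a,b}`, `{c,d}`, `{a,d}` of `H`
are queue-edges and the edge `{u,v}` of `H` is a stack-edge. -/
def Smiley {V : Type} {G : SimpleGraph V} (L : MixedLayout G) (H : SimpleGraph V)
    (a b u v c d : V) : Prop :=
  L.lt a b ∧ L.lt b u ∧ L.lt u v ∧ L.lt v c ∧ L.lt c d ∧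
  QEdgeIn L H a b ∧ QEdgeIn L H c d ∧ QEdgeIn L H a d ∧ SEdgeIn L H u v

/-- The step at which a vertex is introduced (`0` for the two base vertices). -/
def PV.level {ℓ : ℕ} : PV ℓ → ℕ
  | .A => 0
  | .B => 0
  | .att n _ _ _ => n

theorem level_le_of_mem_Gedges {ℓ : ℕ} :
    ∀ (k : ℕ) {p : PV ℓ × PV ℓ}, p ∈ Gedges ℓ k → p.1.level ≤ k ∧ p.2.level ≤ k
  | 0, _, h => h.elim
  | 1, p, h => by
    have hp : p = (PV.A, PV.B) := h
    subst hp
    exact ⟨Nat.zero_le _, Nat.zero_le _⟩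
  | k + 2, p, h => by
    rcases h with h | ⟨u, v, i, h, rfl | rfl⟩
    · have := level_le_of_mem_Gedges (k + 1) h
      omega
    · exact ⟨le_rfl, (level_le_of_mem_Gedges (k + 1) h).1.trans (Nat.le_succ _)⟩
    · exact ⟨le_rfl, (level_le_of_mem_Gedges (k + 1) h).2.trans (Nat.le_succ _)⟩

theorem Gkl_adj_iff {k ℓ : ℕ} {a b : PV ℓ} :
    (Gkl k ℓ).Adj a b ↔ ((a, b) ∈ Gedges ℓ k ∨ (b, a) ∈ Gedges ℓ k) ∧ a ≠ b := by
  simp only [Gkl, SimpleGraph.fromEdgeSet_adj, Set.mem_image, Prod.exists, Sym2.eq_iff]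
  grind

theorem level_le_of_Gkl_adj {k ℓ : ℕ} {a b : PV ℓ} (h : (Gkl k ℓ).Adj a b) :
    a.level ≤ k ∧ b.level ≤ k := by
  rcases (Gkl_adj_iff.1 h).1 with h | h
  · exact level_le_of_mem_Gedges k h
  · exact (level_le_of_mem_Gedges k h).symm

theorem Gkl_mono_succ (k ℓ : ℕ) : Gkl (k + 1) ℓ ≤ Gkl (k + 2) ℓ := by
  intro a b h
  rw [Gkl_adj_iff] at h ⊢
  exact ⟨h.1.imp Or.inl Or.inl, h.2⟩

/-- Every edge of `G(k+1,ℓ)` has `ℓ` distinct new common neighbours in `G(k+2,ℓ)`. -/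
theorem exists_attached {k ℓ : ℕ} {a b : PV ℓ} (h : (Gkl (k + 1) ℓ).Adj a b) :
    ∃ f : Fin ℓ → PV ℓ, Function.Injective f ∧ (∀ i, (f i).level = k + 2) ∧
      ∀ i, (Gkl (k + 2) ℓ).Adj (f i) a ∧ (Gkl (k + 2) ℓ).Adj (f i) b := by
  have hl := level_le_of_Gkl_adj h
  have key : ∀ u v : PV ℓ, (u, v) ∈ Gedges ℓ (k + 1) → u.level ≤ k + 1 → v.level ≤ k + 1 →
      ∃ f : Fin ℓ → PV ℓ, Function.Injective f ∧ (∀ i, (f i).level = k + 2) ∧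
        ∀ i, (Gkl (k + 2) ℓ).Adj (f i) u ∧ (Gkl (k + 2) ℓ).Adj (f i) v := by
    intro u v huv hu hv
    refine ⟨PV.att (k + 2) u v, fun i j hij => by injection hij, fun i => rfl, fun i => ?_⟩
    refine ⟨Gkl_adj_iff.2 ⟨Or.inl (Or.inr ⟨u, v, i, huv, Or.inl rfl⟩), ?_⟩,
      Gkl_adj_iff.2 ⟨Or.inl (Or.inr ⟨u, v, i, huv, Or.inr rfl⟩), ?_⟩⟩
    · intro h
      rw [← h] at hu
      simp [PV.level] at hu
    · intro h
      rw [← h] at hv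
      simp [PV.level] at hv
  rcases (Gkl_adj_iff.1 h).1 with h | h
  · exact key a b h hl.1 hl.2
  · obtain ⟨f, hf, hlev, hadj⟩ := key b a h hl.2 hl.1
    exact ⟨f, hf, hlev, fun i => (hadj i).symm⟩

section Pattern

variable {V : Type} [LinearOrder V] {S Q : V → V → Prop} {p1 p2 p3 p4 p5 p6 p7 : V}

/-- In the presence of the pattern, a new common neighbour `x` of `p2` and `p4` lies before `p1`
and is a queue-attachment, or lies in one of the gaps `(p2,p4)`, `(p4,p5)` and is a
stack-attachment. -/
theorem attachment_region (symmS : ∀ a b, S a b → S b a) (symmQ : ∀ a b, Q a b → Q b a)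
    (noCross : ∀ a b c d, S a b → S c d → ¬(a < c ∧ c < b ∧ b < d))
    (noNest : ∀ a b c d, Q a b → Q c d → ¬(a < c ∧ c < d ∧ d < b))
    (h12 : p1 < p2) (h23 : p2 < p3) (h34 : p3 < p4) (h45 : p4 < p5) (h56 : p5 < p6)
    (h67 : p6 < p7) (s17 : S p1 p7) (s25 : S p2 p5) (q16 : Q p1 p6) (q37 : Q p3 p7)
    {x : V} (x1 : x ≠ p1) (x2 : x ≠ p2) (x4 : x ≠ p4) (x5 : x ≠ p5) (x6 : x ≠ p6) (x7 : x ≠ p7)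
    (e2 : S x p2 ∨ Q x p2) (e4 : S x p4 ∨ Q x p4) :
    (x < p1 ∧ Q x p2 ∧ Q x p4) ∨
      ((p2 < x ∧ x < p4 ∨ p4 < x ∧ x < p5) ∧ S x p2 ∧ S x p4) := by
  rcases lt_or_gt_of_ne x1 with hx1 | hx1
  · have n2 : ¬ S x p2 := fun h => noCross _ _ _ _ h s17 ⟨hx1, h12, by order⟩
    have n4 : ¬ S x p4 := fun h => noCross _ _ _ _ h s17 ⟨hx1, by order, by order⟩
    exact Or.inl ⟨hx1, e2.resolve_left n2, e4.resolve_left n4⟩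
  rcases lt_or_gt_of_ne x6 with hx6 | hx6
  · have s2 : S x p2 := e2.resolve_right fun h => by
      rcases lt_or_gt_of_ne x2 with hx2 | hx2
      · exact noNest _ _ _ _ q16 h ⟨hx1, hx2, by order⟩
      · exact noNest _ _ _ _ q16 (symmQ _ _ h) ⟨h12, hx2, hx6⟩
    have s4 : S x p4 := e4.resolve_right fun h => by
      rcases lt_or_gt_of_ne x4 with hx4 | hx4
      · exact noNest _ _ _ _ q16 h ⟨hx1, hx4, by order⟩
      · exact noNest _ _ _ _ q16 (symmQ _ _ h) ⟨by order, hx4, hx6⟩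
    refine Or.inr ⟨?_, s2, s4⟩
    rcases lt_or_gt_of_ne x2 with hx2 | hx2
    · exact (noCross _ _ _ _ s4 s25 ⟨hx2, by order, h45⟩).elim
    rcases lt_or_gt_of_ne x5 with hx5 | hx5
    · exact (lt_or_gt_of_ne x4).imp (fun h => ⟨hx2, h⟩) (fun h => ⟨h, hx5⟩)
    · exact (noCross _ _ _ _ s25 (symmS _ _ s4) ⟨by order, h45, hx5⟩).elim
  exfalso
  rcases lt_or_gt_of_ne x7 with hx7 | hx7
  · rcases e4 with h | h
    · exact noCross _ _ _ _ s25 (symmS _ _ h) ⟨by order, h45, by order⟩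
    · exact noNest _ _ _ _ q37 (symmQ _ _ h) ⟨h34, by order, hx7⟩
  · rcases e2 with h | h
    · exact noCross _ _ _ _ s17 (symmS _ _ h) ⟨h12, by order, hx7⟩
    · exact noNest _ _ _ _ (symmQ _ _ h) q37 ⟨h23, by order, hx7⟩

/-- The edge `{p2,p4}` of the pattern has at most three new common neighbours. -/
theorem no_attachments_of_pattern
    (symmS : ∀ a b, S a b → S b a) (symmQ : ∀ a b, Q a b → Q b a)
    (noCross : ∀ a b c d, S a b → S c d → ¬(a < c ∧ c < b ∧ b < d))
    (noNest : ∀ a b c d, Q a b → Q c d → ¬(a < c ∧ c < d ∧ d < b))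
    (h12 : p1 < p2) (h23 : p2 < p3) (h34 : p3 < p4) (h45 : p4 < p5) (h56 : p5 < p6)
    (h67 : p6 < p7) (s17 : S p1 p7) (s25 : S p2 p5) (q16 : Q p1 p6) (q37 : Q p3 p7)
    {ℓ : ℕ} (hl : 3 < ℓ) {f : Fin ℓ → V} (hf : Function.Injective f)
    (hne : ∀ i, f i ≠ p1 ∧ f i ≠ p2 ∧ f i ≠ p4 ∧ f i ≠ p5 ∧ f i ≠ p6 ∧ f i ≠ p7)
    (hadj : ∀ i, (S (f i) p2 ∨ Q (f i) p2) ∧ (S (f i) p4 ∨ Q (f i) p4)) : False := by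
  have region := fun i => attachment_region symmS symmQ noCross noNest h12 h23 h34 h45 h56 h67
    s17 s25 q16 q37 (hne i).1 (hne i).2.1 (hne i).2.2.1 (hne i).2.2.2.1 (hne i).2.2.2.2.1
    (hne i).2.2.2.2.2 (hadj i).1 (hadj i).2
  let g : Fin ℓ → Fin 3 := fun i => if f i < p1 then 0 else if f i < p4 then 1 else 2
  have key : ∀ i j, f i < f j → g i ≠ g j := by
    intro i j hij hg
    rcases region i with ⟨hi, qi2, qi4⟩ | ⟨hi, si2, si4⟩ <;>
      rcases region j with ⟨hj, qj2, qj4⟩ | ⟨hj, sj2, sj4⟩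
    · exact noNest _ _ _ _ qi4 qj2 ⟨hij, by order, by order⟩
    · have : ¬ f j < p1 := by rcases hj with hj | hj <;> order
      simp only [g, hi, this, if_true, if_false] at hg
      split_ifs at hg <;> simp at hg
    · exact (show ¬ f i < p1 by rcases hi with hi | hi <;> order) (hij.trans hj)
    · have ni : ¬ f i < p1 := by rcases hi with hi | hi <;> order
      have nj : ¬ f j < p1 := by rcases hj with hj | hj <;> order
      rcases hi with hi | hi <;> rcases hj with hj | hj
      · exact noCross _ _ _ _ (symmS _ _ sj2) si4 ⟨hi.1, hij, hj.2⟩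
      · simp [g, ni, nj, hi.2, hj.1.not_gt] at hg
      · order
      · exact noCross _ _ _ _ (symmS _ _ si2) (symmS _ _ sj4) ⟨by order, hi.1, hij⟩
  obtain ⟨i, j, hij, hg⟩ := Fintype.exists_ne_map_eq_of_card_lt g (by simpa using hl)
  rcases lt_or_gt_of_ne (hf.ne hij) with h | h
  · exact key i j h hg
  · exact key j i h hg.symm

end Pattern

/-- The mixed layout obtained by reversing the vertex order. -/
def MixedLayout.reverse {V : Type} {G : SimpleGraph V} (L : MixedLayout G) : MixedLayout G where
  lt := Function.swap L.lt
  isSTO := have := L.isSTO; inferInstance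
  isStack := L.isStack
  noCross a b c d hab hcd sab scd h :=
    L.noCross d c b a hcd.symm hab.symm (Sym2.eq_swap ▸ scd) (Sym2.eq_swap ▸ sab)
      ⟨h.2.2, h.2.1, h.1⟩
  noNest a b c d hab hcd qab qcd h :=
    L.noNest b a d c hab.symm hcd.symm (Sym2.eq_swap ▸ qab) (Sym2.eq_swap ▸ qcd)
      ⟨h.2.2, h.2.1, h.1⟩

theorem no_increasing_pattern {k ℓ : ℕ} (hl : 3 < ℓ) (L : MixedLayout (Gkl (k + 2) ℓ))
    {p1 p2 p3 p4 p5 p6 p7 : PV ℓ}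
    (h12 : L.lt p1 p2) (h23 : L.lt p2 p3) (h34 : L.lt p3 p4) (h45 : L.lt p4 p5)
    (h56 : L.lt p5 p6) (h67 : L.lt p6 p7)
    (s17 : SEdgeIn L (Gkl (k + 1) ℓ) p1 p7) (s24 : SEdgeIn L (Gkl (k + 1) ℓ) p2 p4)
    (s25 : SEdgeIn L (Gkl (k + 1) ℓ) p2 p5) (q16 : QEdgeIn L (Gkl (k + 1) ℓ) p1 p6)
    (q37 : QEdgeIn L (Gkl (k + 1) ℓ) p3 p7) : False := by
  classical
  have := L.isSTO
  let _ : LinearOrder (PV ℓ) := linearOrderOfSTO L.lt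
  obtain ⟨f, hf, hlev, hadj⟩ := exists_attached s24.1
  have hne : ∀ i (p : PV ℓ), p.level ≤ k + 1 → f i ≠ p := by
    rintro i p hp rfl
    have := hlev i
    omega
  have l17 := level_le_of_Gkl_adj s17.1
  have l24 := level_le_of_Gkl_adj s24.1
  have l25 := level_le_of_Gkl_adj s25.1
  have l16 := level_le_of_Gkl_adj q16.1
  have split : ∀ {a b}, (Gkl (k + 2) ℓ).Adj a b →
      SEdgeIn L (Gkl (k + 2) ℓ) a b ∨ QEdgeIn L (Gkl (k + 2) ℓ) a b := fun {a b} h =>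
    (em (L.isStack s(a, b))).imp (fun hs => ⟨h, hs⟩) (fun hs => ⟨h, hs⟩)
  exact no_attachments_of_pattern (S := SEdgeIn L (Gkl (k + 2) ℓ))
    (Q := QEdgeIn L (Gkl (k + 2) ℓ))
    (fun _ _ h => ⟨h.1.symm, Sym2.eq_swap ▸ h.2⟩) (fun _ _ h => ⟨h.1.symm, Sym2.eq_swap ▸ h.2⟩)
    (fun a b c d h h' => L.noCross a b c d h.1 h'.1 h.2 h'.2)
    (fun a b c d h h' => L.noNest a b c d h.1 h'.1 h.2 h'.2)
    h12 h23 h34 h45 h56 h67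
    ⟨Gkl_mono_succ k ℓ s17.1, s17.2⟩ ⟨Gkl_mono_succ k ℓ s25.1, s25.2⟩
    ⟨Gkl_mono_succ k ℓ q16.1, q16.2⟩ ⟨Gkl_mono_succ k ℓ q37.1, q37.2⟩ hl hf
    (fun i => ⟨hne i _ l17.1, hne i _ l24.1, hne i _ l24.2, hne i _ l25.2, hne i _ l16.2,
      hne i _ l17.2⟩)
    (fun i => ⟨split (hadj i).1, split (hadj i).2⟩)

/-- Pattern P.2 is forbidden: no seven vertices `p1 ≺ … ≺ p7` (or `p7 ≺ … ≺ p1`)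
of `G(k-1,ℓ)` with stack-edges `{p1,p7}`, `{p2,p4}`, `{p2,p5}` and queue-edges
`{p1,p6}`, `{p3,p7}` of `G(k-1,ℓ)`. -/
theorem no_pattern_P2 (k ℓ : ℕ) (hk : 1 < k) (hl : 4 < ℓ)
    (L : MixedLayout (Gkl k ℓ)) :
    ¬∃ p1 p2 p3 p4 p5 p6 p7 : PV ℓ,
      ((L.lt p1 p2 ∧ L.lt p2 p3 ∧ L.lt p3 p4 ∧ L.lt p4 p5 ∧ L.lt p5 p6 ∧ L.lt p6 p7) ∨
        (L.lt p7 p6 ∧ L.lt p6 p5 ∧ L.lt p5 p4 ∧ L.lt p4 p3 ∧ L.lt p3 p2 ∧ L.lt p2 p1)) ∧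
      SEdgeIn L (Gkl (k - 1) ℓ) p1 p7 ∧ SEdgeIn L (Gkl (k - 1) ℓ) p2 p4 ∧
      SEdgeIn L (Gkl (k - 1) ℓ) p2 p5 ∧ QEdgeIn L (Gkl (k - 1) ℓ) p1 p6 ∧
      QEdgeIn L (Gkl (k - 1) ℓ) p3 p7 := by
  obtain ⟨k, rfl⟩ : ∃ m, k = m + 2 := ⟨k - 2, by omega⟩
  rintro ⟨p1, p2, p3, p4, p5, p6, p7,
    ⟨h12, h23, h34, h45, h56, h67⟩ | ⟨h67, h56, h45, h34, h23, h12⟩, s17, s24, s25, q16, q37⟩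
  · exact no_increasing_pattern (by omega) L h12 h23 h34 h45 h56 h67 s17 s24 s25 q16 q37
  · exact no_increasing_pattern (by omega) L.reverse h12 h23 h34 h45 h56 h67 s17 s24 s25 q16 q37
end

section
/- Let L be a mixed 1-stack 1-queue layout of G(k,ℓ) with k > 1 and ℓ > 4. Let {a,b} be an edge of G(k-1,ℓ) with a ≺ b, and suppose there is a queue-edge {c,d} of G(k,ℓ) with c ≺ a ≺ b ≺ d. Then at least one of the ℓ vertices of Ḡ(k,ℓ) attached to {a,b} is a mixed-attachment of {a,b}. -/
section Layout

variable {V : Type} {G : SimpleGraph V} (L : MixedLayout G) {a b c d x y : V}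

namespace MixedLayout

theorem lt_trans (h₁ : L.lt a b) (h₂ : L.lt b c) : L.lt a c :=
  L.isSTO.toIsTrans.trans _ _ _ h₁ h₂

theorem lt_or_gt (h : a ≠ b) : L.lt a b ∨ L.lt b a := by
  have := L.isSTO.toTrichotomous.trichotomous a b
  tauto

end MixedLayout

theorem StackAtt.swap {L : MixedLayout G} (h : StackAtt L x a b) :
    SEdgeIn L G a x ∧ SEdgeIn L G b x := by
  obtain ⟨⟨h₁, h₂⟩, h₃, h₄⟩ := h
  exact ⟨⟨h₁.symm, Sym2.eq_swap ▸ h₂⟩, h₃.symm, Sym2.eq_swap ▸ h₄⟩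

theorem QueueAtt.swap {L : MixedLayout G} (h : QueueAtt L x a b) :
    QEdgeIn L G a x ∧ QEdgeIn L G b x := by
  obtain ⟨⟨h₁, h₂⟩, h₃, h₄⟩ := h
  exact ⟨⟨h₁.symm, Sym2.eq_swap ▸ h₂⟩, h₃.symm, Sym2.eq_swap ▸ h₄⟩

theorem SEdgeIn.not_cross {L : MixedLayout G} (h : SEdgeIn L G a b) (h' : SEdgeIn L G c d)
    (hac : L.lt a c) (hcb : L.lt c b) (hbd : L.lt b d) : False :=
  L.noCross a b c d h.1 h'.1 h.2 h'.2 ⟨hac, hcb, hbd⟩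

theorem QEdgeIn.not_nest {L : MixedLayout G} (h : QEdgeIn L G a b) (h' : QEdgeIn L G c d)
    (hac : L.lt a c) (hcd : L.lt c d) (hdb : L.lt d b) : False :=
  L.noNest a b c d h.1 h'.1 h.2 h'.2 ⟨hac, hcd, hdb⟩

/-- Two stack-attachments of an edge cannot both lie between its endpoints, nor both outside. -/
theorem StackAtt.not_same_side {L : MixedLayout G} (hab : L.lt a b) (hx : StackAtt L x a b)
    (hy : StackAtt L y a b) (hxy : L.lt x y)
    (h : (L.lt a x ∧ L.lt x b) ↔ (L.lt a y ∧ L.lt y b)) : False := by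
  obtain ⟨hax, hbx⟩ := hx.swap
  obtain ⟨hay, hby⟩ := hy.swap
  have ⟨hxa, hxb⟩ := hx
  have ⟨hya, hyb⟩ := hy
  by_cases hin : L.lt a x ∧ L.lt x b
  · exact hay.not_cross hxb hin.1 hxy (h.1 hin).2
  have hout : ∀ z, StackAtt L z a b → ¬(L.lt a z ∧ L.lt z b) → L.lt z a ∨ L.lt b z := by
    intro z hz hz'
    have h₁ := L.lt_or_gt hz.1.1.ne
    have h₂ := L.lt_or_gt hz.2.1.ne
    tauto
  rcases hout x hx hin with h₁ | h₁
  · rcases hout y hy (fun hy' => hin (h.2 hy')) with h₂ | h₂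
    · exact hxa.not_cross hyb hxy h₂ hab
    · exact hxb.not_cross hay h₁ hab h₂
  · exact hax.not_cross hby hab h₁ hxy

/-- A queue-attachment of an edge lying under a queue-edge is not between the endpoints. -/
theorem QueueAtt.lt_or_gt {L : MixedLayout G} (hcd : QEdgeIn L G c d) (hca : L.lt c a)
    (hbd : L.lt b d) (hx : QueueAtt L x a b) : L.lt x a ∨ L.lt b x := by
  have h₁ := L.lt_or_gt hx.1.1.ne
  have h₂ := L.lt_or_gt hx.2.1.ne
  by_contra! hcon
  have hax : L.lt a x := by tauto
  have hxb : L.lt x b := by tauto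
  exact hcd.not_nest hx.swap.1 hca hax (L.lt_trans hxb hbd)

/-- An edge lying under a queue-edge has at most one queue-attachment on each side. -/
theorem QueueAtt.not_same_side {L : MixedLayout G} (hab : L.lt a b) (hcd : QEdgeIn L G c d)
    (hca : L.lt c a) (hbd : L.lt b d) (hx : QueueAtt L x a b) (hy : QueueAtt L y a b)
    (hxy : L.lt x y) (h : L.lt x a ↔ L.lt y a) : False := by
  rcases hx.lt_or_gt hcd hca hbd with h₁ | h₁
  · exact hx.2.not_nest hy.1 hxy (h.1 h₁) hab
  · exact hy.swap.1.not_nest hx.swap.2 hab h₁ hxy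

/-- Among more than four common neighbours of the endpoints of an edge lying under a
queue-edge, one is a mixed-attachment. -/
theorem exists_mixedAtt_of_four_lt_card {ι : Type} [Fintype ι] (hι : 4 < Fintype.card ι)
    (x : ι → V) (hx : Function.Injective x) (hxa : ∀ i, G.Adj (x i) a)
    (hxb : ∀ i, G.Adj (x i) b) (hab : L.lt a b) (hcd : QEdgeIn L G c d) (hca : L.lt c a)
    (hbd : L.lt b d) : ∃ i, MixedAtt L (x i) a b := by
  classical
  by_contra! hmix
  have hatt : ∀ i, (L.isStack s(x i, a) ∧ StackAtt L (x i) a b) ∨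
      (¬L.isStack s(x i, a) ∧ QueueAtt L (x i) a b) := by
    intro i
    have h₁ := hmix i
    have h₂ := hxa i
    have h₃ := hxb i
    unfold MixedAtt at h₁
    unfold StackAtt QueueAtt
    unfold SEdgeIn QEdgeIn at *
    tauto
  let f : ι → Bool × Bool := fun i => if L.isStack s(x i, a) then
    (true, decide (L.lt a (x i) ∧ L.lt (x i) b)) else (false, decide (L.lt (x i) a))
  have key : ∀ i j, f i = f j → ¬L.lt (x i) (x j) := by
    intro i j hf hlt
    rcases hatt i with ⟨hi, hi'⟩ | ⟨hi, hi'⟩ <;> rcases hatt j with ⟨hj, hj'⟩ | ⟨hj, hj'⟩ <;>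
      simp only [f, hi, hj, if_true, if_false, Prod.mk.injEq, decide_eq_decide, true_and,
        Bool.false_eq_true, reduceCtorEq, false_and] at hf
    · exact hi'.not_same_side hab hj' hlt hf
    · exact hi'.not_same_side hab hcd hca hbd hj' hlt hf
  have hf : Function.Injective f := by
    intro i j hij
    by_contra hne
    rcases L.lt_or_gt (hx.ne hne) with h | h
    · exact key i j hij h
    · exact key j i hij.symm h
  have hcard := Fintype.card_le_of_injective f hf
  simp only [Fintype.card_prod, Fintype.card_bool] at hcard
  omega

end Layout

theorem ne_att_of_mem_Gedges {ℓ : ℕ} : ∀ {m : ℕ} {u v : PV ℓ}, (u, v) ∈ Gedges ℓ m →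
    ∀ {n : ℕ}, m < n → ∀ p q i, u ≠ PV.att n p q i ∧ v ≠ PV.att n p q i
  | 0, _, _, h, _, _, _, _, _ => by simp [Gedges] at h
  | 1, _, _, h, _, _, _, _, _ => by
    simp only [Gedges, Set.mem_ofPred_eq, Prod.mk.injEq] at h
    simp [h.1, h.2]
  | m + 2, u, v, h, n, hn, p, q, i => by
    rcases h with h | ⟨u', v', j, h, h' | h'⟩
    · exact ne_att_of_mem_Gedges h (by omega) p q i
    all_goals
      obtain ⟨rfl, rfl⟩ := Prod.mk.inj h'
      have := ne_att_of_mem_Gedges h (n := n) (by omega) p q i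
      refine ⟨fun he => ?_, by tauto⟩
      injection he
      omega

theorem Gbar_le_Gkl (k ℓ : ℕ) : Gbar k ℓ ≤ Gkl k ℓ :=
  SimpleGraph.fromEdgeSet_mono (Set.image_mono Set.sdiff_subset)

theorem att_attachedAt {k ℓ : ℕ} {u v : PV ℓ} (h : (u, v) ∈ Gedges ℓ (k + 1)) (i : Fin ℓ) :
    AttachedAt ℓ (k + 2) (PV.att (k + 2) u v i) u v := by
  have hne := ne_att_of_mem_Gedges h (n := k + 2) (by omega) u v i
  have hnew : ∀ w, (PV.att (k + 2) u v i, w) ∉ Gedges ℓ (k + 1) := fun w hw =>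
    (ne_att_of_mem_Gedges hw (n := k + 2) (by omega) u v i).1 rfl
  refine ⟨?_, ?_⟩ <;> refine (SimpleGraph.fromEdgeSet_adj _).2 ⟨⟨_, ⟨?_, hnew _⟩, rfl⟩, ?_⟩
  · exact Or.inr ⟨u, v, i, h, Or.inl rfl⟩
  · exact hne.1.symm
  · exact Or.inr ⟨u, v, i, h, Or.inr rfl⟩
  · exact hne.2.symm

theorem exists_injective_attachedAt {k ℓ : ℕ} {a b : PV ℓ} (hab : (Gkl (k + 1) ℓ).Adj a b) :
    ∃ x : Fin ℓ → PV ℓ, Function.Injective x ∧ ∀ i, AttachedAt ℓ (k + 2) (x i) a b := by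
  obtain ⟨⟨⟨u, v⟩, huv, he⟩, -⟩ := (SimpleGraph.fromEdgeSet_adj _).1 hab
  refine ⟨PV.att (k + 2) u v, fun i j hij => by injection hij, fun i => ?_⟩
  have h := att_attachedAt huv i
  rcases Sym2.eq_iff.1 he with ⟨rfl, rfl⟩ | ⟨rfl, rfl⟩
  · exact h
  · exact h.symm

/-- If `{a,b}` is an edge of `G(k-1,ℓ)` with `a ≺ b` and there is a queue-edge
`{c,d}` of `G(k,ℓ)` with `c ≺ a ≺ b ≺ d`, then at least one of the vertices of
`Ḡ(k,ℓ)` attached to `{a,b}` is a mixed-attachment of `{a,b}`. -/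
theorem exists_mixed_attachment (k ℓ : ℕ) (hk : 1 < k) (hl : 4 < ℓ)
    (L : MixedLayout (Gkl k ℓ)) (a b c d : PV ℓ)
    (hab : (Gkl (k - 1) ℓ).Adj a b) (hablt : L.lt a b)
    (hcd : QEdgeIn L (Gkl k ℓ) c d) (hca : L.lt c a) (hbd : L.lt b d) :
    ∃ x : PV ℓ, AttachedAt ℓ k x a b ∧ MixedAtt L x a b := by
  obtain ⟨k, rfl⟩ : ∃ m, k = m + 2 := ⟨k - 2, by omega⟩
  obtain ⟨x, hx, hatt⟩ := exists_injective_attachedAt hab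
  obtain ⟨i, hi⟩ := exists_mixedAtt_of_four_lt_card L (by simpa using hl) x hx
    (fun i => Gbar_le_Gkl _ _ (hatt i).1) (fun i => Gbar_le_Gkl _ _ (hatt i).2)
    hablt hcd hca hbd
  exact ⟨x i, hatt i, hi⟩
end

section
/- Let L be a mixed 1-stack 1-queue layout of G(k,ℓ) with k > 4 and ℓ > 6, let {u,v} be a queue-edge of G(k-3,ℓ) with u ≺ v, and let x1,…,x7 be queue-attachments of {u,v} in Ḡ(k-2,ℓ) with u ≺ x1 ≺ … ≺ x7 ≺ v. Then for every i with 2 ≤ i ≤ 6 and every vertex w of Ḡ(k-1,ℓ) attached to the edge {u,x_i} or to the edge {v,x_i}, the edge {w,x_i} is not a queue-edge. -/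
theorem Gedges_mono (ℓ : ℕ) : Monotone (Gedges ℓ) := by
  refine monotone_nat_of_le_succ fun n => ?_
  cases n with
  | zero => exact Set.empty_subset _
  | succ n => exact Set.subset_union_left

theorem Gkl_mono {ℓ m n : ℕ} (h : m ≤ n) : Gkl m ℓ ≤ Gkl n ℓ :=
  SimpleGraph.fromEdgeSet_mono (Set.image_mono (Gedges_mono ℓ h))

/-- Apart from the base edge, the first vertex of an oriented edge has the second one among its
constructor arguments. -/
theorem Gedges_base_or_sizeOf_lt {ℓ n : ℕ} {a b : PV ℓ} (h : (a, b) ∈ Gedges ℓ n) :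
    (a = PV.A ∧ b = PV.B) ∨ sizeOf b < sizeOf a := by
  induction n using Nat.strong_induction_on generalizing a b with
  | _ n ih =>
    match n, h with
    | 1, h => exact Or.inl (Prod.mk.injEq .. ▸ h)
    | n + 2, Or.inl h => exact ih (n + 1) (by omega) h
    | n + 2, Or.inr ⟨u, v, i, _, h⟩ =>
      rcases h with h | h <;> obtain ⟨rfl, rfl⟩ := Prod.mk.inj h <;> right <;>
        rw [PV.att.sizeOf_spec] <;> omega

theorem Gedges_antisymm {ℓ m n : ℕ} {a b : PV ℓ} (hab : (a, b) ∈ Gedges ℓ m) :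
    (b, a) ∉ Gedges ℓ n := by
  intro hba
  rcases Gedges_base_or_sizeOf_lt hab with ⟨rfl, rfl⟩ | h
  · rcases Gedges_base_or_sizeOf_lt hba with ⟨h, _⟩ | h <;> simp at h
  · rcases Gedges_base_or_sizeOf_lt hba with ⟨rfl, rfl⟩ | h'
    · simp at h
    · omega

/-- The new edges of `Ḡ(n,ℓ)` are not edges of any earlier `G(m,ℓ)`. -/
theorem not_Gkl_adj_of_Gbar_adj {ℓ m n : ℕ} (hmn : m ≤ n - 1) {a b : PV ℓ}
    (h : (Gbar n ℓ).Adj a b) : ¬(Gkl m ℓ).Adj a b := by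
  intro h'
  obtain ⟨⟨⟨p, q⟩, ⟨hp, hp'⟩, hpab⟩, _⟩ := (SimpleGraph.fromEdgeSet_adj _).1 h
  obtain ⟨⟨⟨r, s⟩, hr, hrab⟩, _⟩ := (SimpleGraph.fromEdgeSet_adj _).1 h'
  rcases Sym2.eq_iff.1 (hpab.trans hrab.symm) with ⟨rfl, rfl⟩ | ⟨rfl, rfl⟩
  · exact hp' (Gedges_mono ℓ hmn hr)
  · exact Gedges_antisymm hp hr

/-- If `{u,v}`, `{u,a}` and `{b,v}` are queue-edges with `u ≺ a ≺ y ≺ b ≺ v`, then every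
queue-edge at `y` ends at `u` or `v`. -/
theorem MixedLayout.eq_or_eq_of_queue {V : Type} {G : SimpleGraph V} (L : MixedLayout G)
    {u v a b y w : V} (huv : QEdgeIn L G u v) (hua : QEdgeIn L G u a) (hbv : QEdgeIn L G b v)
    (hwy : QEdgeIn L G w y) (h₁ : L.lt u a) (h₂ : L.lt a y) (h₃ : L.lt y b) (h₄ : L.lt b v) :
    w = u ∨ w = v := by
  have := L.isSTO
  have hyw : QEdgeIn L G y w := ⟨hwy.1.symm, Sym2.eq_swap (a := w) ▸ hwy.2⟩
  rcases trichotomous_of L.lt w u with h | h | h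
  · exact (L.noNest w y u a hwy.1 hua.1 hwy.2 hua.2 ⟨h, h₁, h₂⟩).elim
  · exact Or.inl h
  rcases trichotomous_of L.lt w v with h' | h' | h'
  · rcases trichotomous_of L.lt w y with hlt | rfl | hlt
    · exact (L.noNest u v w y huv.1 hwy.1 huv.2 hwy.2
        ⟨h, hlt, _root_.trans h₃ h₄⟩).elim
    · exact (G.loopless.irrefl _ hwy.1).elim
    · exact (L.noNest u v y w huv.1 hyw.1 huv.2 hyw.2
        ⟨_root_.trans h₁ h₂, hlt, h'⟩).elim
  · exact Or.inr h'
  · exact (L.noNest y w b v hyw.1 hbv.1 hyw.2 hbv.2 ⟨h₃, h₄, h'⟩).elim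

/-- Setting of Lemma 4: `{u,v}` a queue-edge of `G(k-3,ℓ)` with `u ≺ v` and
`x 0 , …, x 6` queue-attachments of `{u,v}` in `Ḡ(k-2,ℓ)` with
`u ≺ x 0 ≺ … ≺ x 6 ≺ v`. Then for every `i` with `2 ≤ i ≤ 6` (here `1 ≤ j ≤ 5`)
and every vertex `w` of `Ḡ(k-1,ℓ)` attached to `{u, x j}` or `{v, x j}`, the edge
`{w, x j}` is not a queue-edge. -/
theorem attachment_edge_not_queue (k ℓ : ℕ) (hk : 4 < k) (hl : 6 < ℓ)
    (L : MixedLayout (Gkl k ℓ)) (u v : PV ℓ)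
    (huv : QEdgeIn L (Gkl (k - 3) ℓ) u v) (huvlt : L.lt u v)
    (x : Fin 7 → PV ℓ)
    (hatt : ∀ j, AttachedAt ℓ (k - 2) (x j) u v ∧ QueueAtt L (x j) u v)
    (hx0 : L.lt u (x 0)) (hx6 : L.lt (x 6) v)
    (hmono : ∀ j j' : Fin 7, j < j' → L.lt (x j) (x j')) :
    ∀ j : Fin 7, 1 ≤ (j : ℕ) → (j : ℕ) ≤ 5 →
      ∀ w : PV ℓ,
        (AttachedAt ℓ (k - 1) w u (x j) ∨ AttachedAt ℓ (k - 1) w v (x j)) →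
        ¬QEdgeIn L (Gkl k ℓ) w (x j) := by
  intro j hj1 hj5 w hw hq
  have hxu := (hatt 0).2.1
  have hu : QEdgeIn L (Gkl k ℓ) u (x 0) := ⟨hxu.1.symm, Sym2.eq_swap (a := x 0) ▸ hxu.2⟩
  have huv' : QEdgeIn L (Gkl k ℓ) u v := ⟨Gkl_mono (by omega) huv.1, huv.2⟩
  have h0 : L.lt (x 0) (x j) := hmono 0 j (Fin.lt_def.2 (show 0 < (j : ℕ) by omega))
  have h6 : L.lt (x j) (x 6) := hmono j 6 (Fin.lt_def.2 (show (j : ℕ) < 6 by omega))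
  rcases L.eq_or_eq_of_queue huv' hu (hatt 6).2.2 hq hx0 h0 h6 hx6 with rfl | rfl
  · rcases hw with hw | hw
    · exact (Gbar (k - 1) ℓ).loopless.irrefl _ hw.1
    · exact not_Gkl_adj_of_Gbar_adj (by omega) hw.1 huv.1
  · rcases hw with hw | hw
    · exact not_Gkl_adj_of_Gbar_adj (by omega) hw.1 huv.1.symm
    · exact (Gbar (k - 1) ℓ).loopless.irrefl _ hw.1
end

section
/- Let L be a mixed 1-stack 1-queue layout of G(k,ℓ) with k > 4 and ℓ > 6, let {u,v} be a queue-edge of G(k-3,ℓ) with u ≺ v, and let x1,…,x7 be queue-attachments of {u,v} in Ḡ(k-2,ℓ) with u ≺ x1 ≺ … ≺ x7 ≺ v. Then for 2 ≤ i ≤ 6 there is no vertex w of Ḡ(k-1,ℓ) attached to {v,x_i} that is a mixed-attachment with stack-edge {w,x_i} and satisfies w ≺ u, and there is no vertex w of Ḡ(k-1,ℓ) attached to {u,x_i} that is a mixed-attachment with stack-edge {w,x_i} and satisfies v ≺ w. -/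
/-- Claim 1: in the setting of Lemma 4, for `2 ≤ i ≤ 6` (here `1 ≤ j ≤ 5`) there is
no mixed-attachment `w` of `{v, x j}` with stack-edge `{w, x j}` and `w ≺ u`, and no
mixed-attachment `w` of `{u, x j}` with stack-edge `{w, x j}` and `v ≺ w`. -/
theorem claim_before_u (k ℓ : ℕ) (hk : 4 < k) (hl : 6 < ℓ)
    (L : MixedLayout (Gkl k ℓ)) (u v : PV ℓ)
    (huv : QEdgeIn L (Gkl (k - 3) ℓ) u v) (huvlt : L.lt u v)
    (x : Fin 7 → PV ℓ)
    (hatt : ∀ j, AttachedAt ℓ (k - 2) (x j) u v ∧ QueueAtt L (x j) u v)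
    (hx0 : L.lt u (x 0)) (hx6 : L.lt (x 6) v)
    (hmono : ∀ j j' : Fin 7, j < j' → L.lt (x j) (x j')) :
    ∀ j : Fin 7, 1 ≤ (j : ℕ) → (j : ℕ) ≤ 5 →
      (¬∃ w : PV ℓ, AttachedAt ℓ (k - 1) w v (x j) ∧
        QEdgeIn L (Gkl k ℓ) w v ∧ SEdgeIn L (Gkl k ℓ) w (x j) ∧ L.lt w u) ∧
      (¬∃ w : PV ℓ, AttachedAt ℓ (k - 1) w u (x j) ∧
        QEdgeIn L (Gkl k ℓ) w u ∧ SEdgeIn L (Gkl k ℓ) w (x j) ∧ L.lt v w) := by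
  have := L.isSTO
  have hxv : L.lt (x 0) v := _root_.trans (hmono 0 6 (by decide)) hx6
  obtain ⟨-, ⟨hxu_adj, hxu_queue⟩, hxv_adj, hxv_queue⟩ := hatt 0
  intro j _ _
  constructor
  · rintro ⟨w, -, ⟨hwv_adj, hwv_queue⟩, -, hwu⟩
    exact L.noNest w v u (x 0) hwv_adj hxu_adj.symm hwv_queue
      (by rwa [Sym2.eq_swap]) ⟨hwu, hx0, hxv⟩
  · rintro ⟨w, -, ⟨hwu_adj, hwu_queue⟩, -, hvw⟩
    exact L.noNest u w (x 0) v hwu_adj.symm hxv_adj (by rwa [Sym2.eq_swap])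
      hxv_queue ⟨hx0, hxv, hvw⟩
end

section
/- Let L be a mixed 1-stack 1-queue layout of G(k,ℓ) with k > 4 and ℓ > 6, let {u,v} be a queue-edge of G(k-3,ℓ) with u ≺ v, and let x1,…,x7 be queue-attachments of {u,v} in Ḡ(k-2,ℓ) with u ≺ x1 ≺ … ≺ x7 ≺ v. Then for 2 ≤ i ≤ 6 there is no vertex w of Ḡ(k-1,ℓ) attached to {v,x_i} or to {u,x_i} that is a mixed-attachment with stack-edge {w,x_i} and satisfies x1 ≺ w ≺ x7. -/
/-- Every vertex of `G(m,ℓ)` was added in one of the first `m` steps. -/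
theorem step_le_of_mem_Gedges {ℓ : ℕ} {m : ℕ} {e : PV ℓ × PV ℓ} (he : e ∈ Gedges ℓ m)
    {n : ℕ} {a b : PV ℓ} {i : Fin ℓ} (h : PV.att n a b i = e.1 ∨ PV.att n a b i = e.2) :
    n ≤ m := by
  induction m using Nat.strong_induction_on generalizing e with
  | _ m ih =>
    match m, he with
    | 1, he =>
      obtain rfl : e = (PV.A, PV.B) := he
      simp at h
    | m + 2, Or.inl he => exact (ih (m + 1) (by lia) he h).trans (by lia)
    | m + 2, Or.inr ⟨u, v, j, huv, he⟩ =>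
      have key : ∀ z, z = u ∨ z = v → PV.att n a b i = z → n ≤ m + 2 := fun z hz hn =>
        (ih (m + 1) (by lia) huv (by rcases hz with rfl | rfl <;> simp [hn])).trans (by lia)
      rcases he with rfl | rfl <;> rcases h with h | h
      · simp only [PV.att.injEq] at h
        lia
      · exact key _ (Or.inl rfl) h
      · simp only [PV.att.injEq] at h
        lia
      · exact key _ (Or.inr rfl) h

theorem Gkl_mono_s15 (ℓ : ℕ) : Monotone (Gkl · ℓ) := by
  refine monotone_nat_of_le_succ fun k a b h => ?_
  rw [Gkl_adj_iff] at h ⊢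
  match k, h with
  | 0, h => simp [Gedges] at h
  | k + 1, h => exact ⟨h.1.imp Or.inl Or.inl, h.2⟩

/-- A vertex of `G(k,ℓ)` incident to an edge is not one added in a later step. -/
theorem att_ne_of_adj {k ℓ n : ℕ} (hn : k < n) {a b c d : PV ℓ} (h : (Gkl k ℓ).Adj a b)
    (i : Fin ℓ) : PV.att n c d i ≠ a := by
  rintro rfl
  rcases (Gkl_adj_iff.1 h).1 with h | h
  · exact hn.not_ge (step_le_of_mem_Gedges h (Or.inl rfl))
  · exact hn.not_ge (step_le_of_mem_Gedges h (Or.inr rfl))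

/-- In `G(k+1,ℓ)`, every edge of `G(k,ℓ)` has `ℓ` attached vertices, all new. -/
theorem exists_attachments {k ℓ : ℕ} {p q : PV ℓ} (h : (Gkl k ℓ).Adj p q) :
    ∃ y : Fin ℓ → PV ℓ, Function.Injective y ∧
      (∀ i, (Gkl (k + 1) ℓ).Adj (y i) p ∧ (Gkl (k + 1) ℓ).Adj (y i) q) ∧
      ∀ i a b, (Gkl k ℓ).Adj a b → y i ≠ a := by
  wlog hpq : (p, q) ∈ Gedges ℓ k generalizing p q
  · obtain ⟨y, hy, hadj, hne⟩ := this h.symm ((Gkl_adj_iff.1 h).1.resolve_left hpq)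
    exact ⟨y, hy, fun i => (hadj i).symm, hne⟩
  refine ⟨PV.att (k + 1) p q, fun i j hij => by simpa using hij, fun i => ?_,
    fun i a b hab => att_ne_of_adj k.lt_succ_self hab i⟩
  match k, hpq with
  | k + 1, hpq =>
    exact ⟨Gkl_adj_iff.2 ⟨Or.inl (Or.inr ⟨p, q, i, hpq, Or.inl rfl⟩),
        att_ne_of_adj (Nat.lt_succ_self _) h i⟩,
      Gkl_adj_iff.2 ⟨Or.inl (Or.inr ⟨p, q, i, hpq, Or.inr rfl⟩),
        att_ne_of_adj (Nat.lt_succ_self _) h.symm i⟩⟩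

section MixedLayout

variable {V : Type} {G : SimpleGraph V} (L : MixedLayout G)

theorem SEdgeIn.symm {L : MixedLayout G} {H : SimpleGraph V} {a b : V}
    (h : SEdgeIn L H a b) : SEdgeIn L H b a :=
  ⟨h.1.symm, Sym2.eq_swap ▸ h.2⟩

theorem QEdgeIn.symm {L : MixedLayout G} {H : SimpleGraph V} {a b : V}
    (h : QEdgeIn L H a b) : QEdgeIn L H b a :=
  ⟨h.1.symm, Sym2.eq_swap ▸ h.2⟩

theorem MixedLayout.lt_trans_s15 {a b c : V} (hab : L.lt a b) (hbc : L.lt b c) : L.lt a c :=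
  L.isSTO.toIsStrictOrder.toIsTrans.trans _ _ _ hab hbc

theorem MixedLayout.lt_or_gt_of_ne {a b : V} (h : a ≠ b) : L.lt a b ∨ L.lt b a := by
  have := L.isSTO
  exact (trichotomous_of L.lt a b).imp_right (Or.resolve_left · h)

/-- Every vertex attached to the stack-edge of a smiley face is a stack-attachment. -/
theorem Smiley.stackAtt {L : MixedLayout G} {a b p q c d y : V}
    (hs : Smiley L G a b p q c d) (hya : y ≠ a) (hyd : y ≠ d)
    (hyp : G.Adj y p) (hyq : G.Adj y q) : StackAtt L y p q := by
  obtain ⟨hab, hbp, hpq, hqc, hcd, eab, ecd, ead, -⟩ := hs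
  have key : ∀ z, G.Adj y z → L.lt b z → L.lt z c → SEdgeIn L G y z := by
    intro z hyz hbz hzc
    by_contra hn
    have e : QEdgeIn L G y z := ⟨hyz, fun h => hn ⟨hyz, h⟩⟩
    have haz := L.lt_trans_s15 hab hbz
    have hzd := L.lt_trans_s15 hzc hcd
    rcases L.lt_or_gt_of_ne hya with h | h
    · exact L.noNest _ _ _ _ e.1 eab.1 e.2 eab.2 ⟨h, hab, hbz⟩
    rcases L.lt_or_gt_of_ne hyd with h' | h'
    · rcases L.lt_or_gt_of_ne hyz.ne with hz | hz
      · exact L.noNest _ _ _ _ ead.1 e.1 ead.2 e.2 ⟨h, hz, hzd⟩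
      · exact L.noNest _ _ _ _ ead.1 e.symm.1 ead.2 e.symm.2 ⟨haz, hz, h'⟩
    · exact L.noNest _ _ _ _ e.symm.1 ecd.1 e.symm.2 ecd.2 ⟨hzc, hcd, h'⟩
  exact ⟨key p hyp hbp (L.lt_trans_s15 hpq hqc), key q hyq (L.lt_trans_s15 hbp hpq) hqc⟩

/-- No pair of vertices has three common neighbours via stack-edges: `K_{2,3}` is not
outerplanar. -/
theorem not_three_stackAtt {p q y₁ y₂ y₃ : V} (hpq : L.lt p q)
    (h₁₂ : y₁ ≠ y₂) (h₁₃ : y₁ ≠ y₃) (h₂₃ : y₂ ≠ y₃) (h₁ : StackAtt L y₁ p q)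
    (h₂ : StackAtt L y₂ p q) (h₃ : StackAtt L y₃ p q) : False := by
  have cross : ∀ {a b c d}, SEdgeIn L G a b → SEdgeIn L G c d →
      L.lt a c → L.lt c b → L.lt b d → False := fun h h' ha hb hc =>
    L.noCross _ _ _ _ h.1 h'.1 h.2 h'.2 ⟨ha, hb, hc⟩
  have inner : ∀ {y z}, y ≠ z → StackAtt L y p q → StackAtt L z p q →
      L.lt p y → L.lt y q → L.lt p z → L.lt z q → False := by
    intro y z hne hy hz py yq pz zq
    rcases L.lt_or_gt_of_ne hne with h | h
    · exact cross hz.1.symm hy.2 py h zq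
    · exact cross hy.1.symm hz.2 pz h yq
  have outer : ∀ {y z}, y ≠ z → StackAtt L y p q → StackAtt L z p q →
      (L.lt y p ∨ L.lt q y) → (L.lt z p ∨ L.lt q z) → False := by
    intro y z hne hy hz hy' hz'
    rcases hy' with hy' | hy' <;> rcases hz' with hz' | hz'
    · rcases L.lt_or_gt_of_ne hne with h | h
      · exact cross hy.1 hz.2 h hz' hpq
      · exact cross hz.1 hy.2 h hy' hpq
    · exact cross hy.2 hz.1.symm hy' hpq hz'
    · exact cross hz.2 hy.1.symm hz' hpq hy'
    · rcases L.lt_or_gt_of_ne hne with h | h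
      · exact cross hy.1.symm hz.2.symm hpq hy' h
      · exact cross hz.1.symm hy.2.symm hpq hz' h
  have pos : ∀ {y}, StackAtt L y p q → (L.lt p y ∧ L.lt y q) ∨ (L.lt y p ∨ L.lt q y) := by
    intro y hy
    have := L.lt_or_gt_of_ne hy.1.1.ne
    have := L.lt_or_gt_of_ne hy.2.1.ne
    tauto
  rcases pos h₁ with i₁ | o₁ <;> rcases pos h₂ with i₂ | o₂
  · exact inner h₁₂ h₁ h₂ i₁.1 i₁.2 i₂.1 i₂.2
  · rcases pos h₃ with i₃ | o₃
    · exact inner h₁₃ h₁ h₃ i₁.1 i₁.2 i₃.1 i₃.2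
    · exact outer h₂₃ h₂ h₃ o₂ o₃
  · rcases pos h₃ with i₃ | o₃
    · exact inner h₂₃ h₂ h₃ i₂.1 i₂.2 i₃.1 i₃.2
    · exact outer h₁₃ h₁ h₃ o₁ o₃
  · exact outer h₁₂ h₁ h₂ o₁ o₂

end MixedLayout

/-- A mixed layout of `G(k+1,ℓ)` with `ℓ ≥ 3` has no smiley face in `G(k,ℓ)`. -/
theorem not_smiley {k ℓ : ℕ} (hl : 3 ≤ ℓ) (L : MixedLayout (Gkl (k + 1) ℓ))
    {a b p q c d : PV ℓ} : ¬Smiley L (Gkl k ℓ) a b p q c d := by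
  rintro ⟨hab, hbp, hpq, hqc, hcd, eab, ecd, ead, epq⟩
  have hle : Gkl k ℓ ≤ Gkl (k + 1) ℓ := Gkl_mono_s15 ℓ k.le_succ
  obtain ⟨y, hy, hadj, hne⟩ := exists_attachments epq.1
  have hs : Smiley L (Gkl (k + 1) ℓ) a b p q c d :=
    ⟨hab, hbp, hpq, hqc, hcd, ⟨hle eab.1, eab.2⟩, ⟨hle ecd.1, ecd.2⟩,
      ⟨hle ead.1, ead.2⟩, ⟨hle epq.1, epq.2⟩⟩
  have hst : ∀ i, StackAtt L (y i) p q := fun i =>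
    hs.stackAtt (hne i _ _ ead.1) (hne i _ _ ead.1.symm) (hadj i).1 (hadj i).2
  have hy' : ∀ i j : Fin 3, i ≠ j → y (Fin.castLE hl i) ≠ y (Fin.castLE hl j) :=
    fun i j hij h => hij (Fin.castLE_injective hl (hy h))
  exact not_three_stackAtt L hpq (hy' 0 1 (by decide)) (hy' 0 2 (by decide))
    (hy' 1 2 (by decide)) (hst _) (hst _) (hst _)

/-- Claim 2: in the setting of Lemma 4, for `2 ≤ i ≤ 6` (here `1 ≤ j ≤ 5`) there is
no mixed-attachment `w` of `{v, x j}` or of `{u, x j}` with stack-edge `{w, x j}`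
and `x 0 ≺ w ≺ x 6`. -/
theorem claim_between_x1_x7 (k ℓ : ℕ) (hk : 4 < k) (hl : 6 < ℓ)
    (L : MixedLayout (Gkl k ℓ)) (u v : PV ℓ)
    (huv : QEdgeIn L (Gkl (k - 3) ℓ) u v) (huvlt : L.lt u v)
    (x : Fin 7 → PV ℓ)
    (hatt : ∀ j, AttachedAt ℓ (k - 2) (x j) u v ∧ QueueAtt L (x j) u v)
    (hx0 : L.lt u (x 0)) (hx6 : L.lt (x 6) v)
    (hmono : ∀ j j' : Fin 7, j < j' → L.lt (x j) (x j')) :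
    ∀ j : Fin 7, 1 ≤ (j : ℕ) → (j : ℕ) ≤ 5 →
      ¬∃ w : PV ℓ,
        ((AttachedAt ℓ (k - 1) w v (x j) ∧ QEdgeIn L (Gkl k ℓ) w v) ∨
          (AttachedAt ℓ (k - 1) w u (x j) ∧ QEdgeIn L (Gkl k ℓ) w u)) ∧
        SEdgeIn L (Gkl k ℓ) w (x j) ∧ L.lt (x 0) w ∧ L.lt w (x 6) := by
  rintro j hj1 hj5 ⟨w, hw, hwx, hw0, hw6⟩
  obtain ⟨k, rfl⟩ : ∃ m, k = m + 1 := ⟨k - 1, by lia⟩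
  have hwadj : (Gkl k ℓ).Adj w (x j) :=
    Gbar_le_Gkl k ℓ (hw.elim (fun h => h.1.2) (fun h => h.1.2))
  have hxadj : ∀ i, (Gkl k ℓ).Adj (x i) u ∧ (Gkl k ℓ).Adj (x i) v := fun i =>
    ⟨Gkl_mono_s15 ℓ (show k + 1 - 2 ≤ k by lia) (Gbar_le_Gkl _ ℓ (hatt i).1.1),
      Gkl_mono_s15 ℓ (show k + 1 - 2 ≤ k by lia) (Gbar_le_Gkl _ ℓ (hatt i).1.2)⟩
  have e0 : QEdgeIn L (Gkl k ℓ) u (x 0) := QEdgeIn.symm ⟨(hxadj 0).1, (hatt 0).2.1.2⟩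
  have e6 : QEdgeIn L (Gkl k ℓ) (x 6) v := ⟨(hxadj 6).2, (hatt 6).2.2.2⟩
  have euv : QEdgeIn L (Gkl k ℓ) u v :=
    ⟨Gkl_mono_s15 ℓ (show k + 1 - 3 ≤ k by lia) huv.1, huv.2⟩
  have ew : SEdgeIn L (Gkl k ℓ) w (x j) := ⟨hwadj, hwx.2⟩
  have hj0 : L.lt (x 0) (x j) := hmono 0 j (by rw [Fin.lt_def]; exact hj1)
  have hj6 : L.lt (x j) (x 6) := hmono j 6 (by rw [Fin.lt_def]; exact Nat.lt_succ_of_le hj5)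
  rcases L.lt_or_gt_of_ne hwadj.ne with h | h
  · exact not_smiley (by lia) L ⟨hx0, hw0, h, hj6, hx6, e0, e6, euv, ew⟩
  · exact not_smiley (by lia) L ⟨hx0, hj0, h, hw6, hx6, e0, e6, euv, ew.symm⟩
end

section
/- In every mixed 1-stack 1-queue layout of G(k,ℓ) with k ≥ 2 and ℓ > 2, at least one edge of the subgraph G(2,ℓ) is a queue-edge. -/
theorem Gkl_mono_s18 (ℓ : ℕ) : Monotone fun k => Gkl k ℓ := fun _ _ h =>
  SimpleGraph.fromEdgeSet_mono (Set.image_mono (Gedges_mono ℓ h))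

theorem Gkl_two_adj_left {ℓ : ℕ} (i : Fin ℓ) :
    (Gkl 2 ℓ).Adj (PV.att 2 PV.A PV.B i) PV.A := by
  refine (SimpleGraph.fromEdgeSet_adj _).2 ⟨⟨(PV.att 2 PV.A PV.B i, PV.A), ?_, rfl⟩, by simp⟩
  exact Or.inr ⟨PV.A, PV.B, i, rfl, Or.inl rfl⟩

theorem Gkl_two_adj_right {ℓ : ℕ} (i : Fin ℓ) :
    (Gkl 2 ℓ).Adj (PV.att 2 PV.A PV.B i) PV.B := by
  refine (SimpleGraph.fromEdgeSet_adj _).2 ⟨⟨(PV.att 2 PV.A PV.B i, PV.B), ?_, rfl⟩, by simp⟩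
  exact Or.inr ⟨PV.A, PV.B, i, rfl, Or.inr rfl⟩

/-- If `E` is a symmetric relation without crossing pairs on a linear order, then of two common
neighbours of `p < q` exactly one lies between `p` and `q`. -/
theorem between_iff_not_between {V : Type*} [LinearOrder V] {E : V → V → Prop}
    (symm : ∀ a b, E a b → E b a)
    (noCross : ∀ a b c d, E a b → E c d → ¬(a < c ∧ c < b ∧ b < d))
    {p q x y : V} (hpq : p < q) (hxy : x ≠ y) (hxp' : x ≠ p) (hxq' : x ≠ q)
    (hyp' : y ≠ p) (hyq' : y ≠ q)
    (hxp : E x p) (hxq : E x q) (hyp : E y p) (hyq : E y q) :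
    (p < x ∧ x < q) ↔ ¬(p < y ∧ y < q) := by
  wlog h : x < y generalizing x y
  · have := this hxy.symm hyp' hyq' hxp' hxq' hyp hyq hxp hxq
      (lt_of_le_of_ne (not_lt.1 h) hxy.symm)
    tauto
  have inner := noCross p y x q (symm _ _ hyp) hxq
  have outer := noCross x q p y hxq (symm _ _ hyp)
  have left := noCross x p y q hxp hyq
  have right := noCross p x q y (symm _ _ hxp) (symm _ _ hyq)
  grind

/-- The complete bipartite graph `K(2,3)` has no layout without crossing edges. -/
theorem false_of_three_common_neighbors {V : Type*} [LinearOrder V] {E : V → V → Prop}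
    (symm : ∀ a b, E a b → E b a)
    (noCross : ∀ a b c d, E a b → E c d → ¬(a < c ∧ c < b ∧ b < d))
    {p q : V} (hpq : p ≠ q) (x : Fin 3 → V) (hx : Function.Injective x)
    (hxp' : ∀ i, x i ≠ p) (hxq' : ∀ i, x i ≠ q)
    (hxp : ∀ i, E (x i) p) (hxq : ∀ i, E (x i) q) : False := by
  wlog h : p < q generalizing p q
  · exact this hpq.symm hxq' hxp' hxq hxp (lt_of_le_of_ne (not_lt.1 h) hpq.symm)
  have key (i j : Fin 3) (hij : i ≠ j) :=
    between_iff_not_between symm noCross h (hx.ne hij) (hxp' i) (hxq' i) (hxp' j) (hxq' j)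
      (hxp i) (hxq i) (hxp j) (hxq j)
  have h01 := key 0 1 (by decide)
  have h02 := key 0 2 (by decide)
  have h12 := key 1 2 (by decide)
  tauto

/-- In every mixed 1-stack 1-queue layout of `G(k,ℓ)` with `k ≥ 2` and `ℓ > 2`,
at least one edge of the subgraph `G(2,ℓ)` is a queue-edge. -/
theorem exists_queue_edge (k ℓ : ℕ) (hk : 2 ≤ k) (hl : 2 < ℓ)
    (L : MixedLayout (Gkl k ℓ)) :
    ∃ u v : PV ℓ, QEdgeIn L (Gkl 2 ℓ) u v := by
  classical
  by_contra hno
  have stack (u v : PV ℓ) (h : (Gkl 2 ℓ).Adj u v) : L.isStack s(u, v) := by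
    by_contra hs
    exact hno ⟨u, v, h, hs⟩
  have := L.isSTO
  let _ : LinearOrder (PV ℓ) := linearOrderOfSTO L.lt
  refine false_of_three_common_neighbors (E := (Gkl 2 ℓ).Adj) (fun _ _ h => h.symm)
    (fun a b c d hab hcd => L.noCross a b c d (Gkl_mono_s18 ℓ hk hab) (Gkl_mono_s18 ℓ hk hcd)
      (stack _ _ hab) (stack _ _ hcd))
    (p := PV.A) (q := PV.B) (by simp) (fun i => PV.att 2 PV.A PV.B (Fin.castLE hl i))
    (fun i j hij => ?_) (by simp) (by simp)
    (fun i => Gkl_two_adj_left _) (fun i => Gkl_two_adj_right _)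
  simpa using hij
end
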